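/- If K is a CM-field of degree six over ℚ, then every element of K is preperiodic under iteration of the Mahler measure M. -/

import Mathlib

open Polynomial

noncomputable def intMinpoly (α : ℂ) : Polynomial ℤ :=
  (IsLocalization.integerNormalization (nonZeroDivisors ℤ) (minpoly ℚ α)).primPart

noncomputable def mahlerM (α : ℂ) : ℝ :=
  ((intMinpoly α).leadingCoeff.natAbs : ℝ) *
    (((intMinpoly α).map (Int.castRingHom ℂ)).roots.map (fun z => max 1 ‖z‖)).prod

noncomputable def mahlerC (α : ℂ) : ℂ := (mahlerM α : ℝ)

def TorsionFree (α : ℂ) : Prop :=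
  ∀ σ : ℂ ≃ₐ[ℚ] ℂ, σ α ≠ α → ∀ n : ℕ, 0 < n → (α / σ α) ^ n ≠ 1


theorem intMinpoly_map (α : ℂ) (h : IsIntegral ℚ α) :
    ∃ q : ℚ, q ≠ 0 ∧ (intMinpoly α).map (algebraMap ℤ ℚ) = C q * minpoly ℚ α := by
  obtain ⟨b, hbm, hb⟩ := IsLocalization.integerNormalization_spec (nonZeroDivisors ℤ) (minpoly ℚ α)
  set p := IsLocalization.integerNormalization (nonZeroDivisors ℤ) (minpoly ℚ α) with hp
  have hb0 : (b : ℚ) ≠ 0 := by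
    have := nonZeroDivisors.ne_zero hbm
    exact_mod_cast this
  have hm := minpoly.ne_zero h
  have hp0 : p ≠ 0 := by
    intro h0
    rw [h0, Polynomial.map_zero] at hb
    have : (C (b : ℚ)) * minpoly ℚ α = 0 := by
      rw [hb, zsmul_eq_mul]; simp
    simp_all
  have hc : (p.content : ℚ) ≠ 0 := by
    have : p.content ≠ 0 := by rwa [Ne, content_eq_zero_iff]
    exact_mod_cast this
  refine ⟨(b : ℚ) / (p.content : ℚ), div_ne_zero hb0 hc, ?_⟩
  have h1 : p.map (algebraMap ℤ ℚ) = C (p.content : ℚ) * (intMinpoly α).map (algebraMap ℤ ℚ) := by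
    conv_lhs => rw [p.eq_C_content_mul_primPart]
    simp [intMinpoly, ← hp]
  have h2 : C (p.content : ℚ) * (intMinpoly α).map (algebraMap ℤ ℚ) = C (b : ℚ) * minpoly ℚ α := by
    rw [← h1, hb, zsmul_eq_mul]; simp
  have h3 : (C (p.content : ℚ) : ℚ[X]) ≠ 0 := by simpa using hc
  apply mul_left_cancel₀ h3
  rw [h2, ← mul_assoc, ← C_mul, mul_div_cancel₀ _ hc]

theorem intMinpoly_ne_zero (α : ℂ) (h : IsIntegral ℚ α) : intMinpoly α ≠ 0 := by
  obtain ⟨q, hq, he⟩ := intMinpoly_map α h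
  intro h0
  rw [h0] at he
  have := minpoly.ne_zero h
  simp_all

theorem intMinpoly_roots (α : ℂ) (h : IsIntegral ℚ α) :
    ((intMinpoly α).map (Int.castRingHom ℂ)).roots = (minpoly ℚ α).aroots ℂ := by
  obtain ⟨q, hq, he⟩ := intMinpoly_map α h
  have : (intMinpoly α).map (Int.castRingHom ℂ)
     = C (q : ℂ) * (minpoly ℚ α).map (algebraMap ℚ ℂ) := by
    have := congrArg (Polynomial.map (algebraMap ℚ ℂ)) he
    rw [Polynomial.map_map, Polynomial.map_mul, map_C] at this
    convert this using 2
    · congr 1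
    · simp
  rw [this, roots_C_mul _ (by exact_mod_cast hq)]

theorem intMinpoly_lead (α : ℂ) (h : IsIntegral ℤ α) :
    (intMinpoly α).leadingCoeff.natAbs = 1 := by
  have hQ : IsIntegral ℚ α := h.tower_top
  obtain ⟨q, hq, he⟩ := intMinpoly_map α hQ
  have hm := minpoly.isIntegrallyClosed_eq_field_fractions' ℚ h
  have hmon := minpoly.monic h
  have hd : intMinpoly α ∣ minpoly ℤ α := by
    refine (IsPrimitive.Int.dvd_iff_map_cast_dvd_map_cast (intMinpoly α) _ (isPrimitive_primPart _)).2 ?_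
    have e1 : (Int.castRingHom ℚ) = algebraMap ℤ ℚ := rfl
    rw [e1, he, ← hm]
    refine ⟨C q⁻¹, ?_⟩
    rw [mul_right_comm, ← C_mul, mul_inv_cancel₀ hq]; simp
  obtain ⟨r, hr⟩ := hd
  have := congrArg leadingCoeff hr
  rw [leadingCoeff_mul, hmon.leadingCoeff] at this
  exact Int.isUnit_iff_natAbs_eq.mp (IsUnit.of_mul_eq_one _ this.symm)

theorem mahlerM_eq (α : ℂ) (h : IsIntegral ℚ α) :
    mahlerM α = ((intMinpoly α).leadingCoeff.natAbs : ℝ) *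
    (((minpoly ℚ α).aroots ℂ).map (fun z => max 1 ‖z‖)).prod := by
  rw [mahlerM, intMinpoly_roots α h]

theorem mahlerM_eq' (α : ℂ) (h : IsIntegral ℤ α) :
    mahlerM α = (((minpoly ℚ α).aroots ℂ).map (fun z => max 1 ‖z‖)).prod := by
  rw [mahlerM_eq α h.tower_top, intMinpoly_lead α h]; simp

/-- dividing out a root preserves integrality of coefficients -/
theorem div_root (z : ℂ) : ∀ n : ℕ, ∀ f : (integralClosure ℤ ℂ)[X], f.natDegree ≤ n →
    aeval z f = 0 → ∃ g : (integralClosure ℤ ℂ)[X],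
      f.map (algebraMap _ ℂ) = (X - C z) * g.map (algebraMap _ ℂ) := by
  intro n
  induction n with
  | zero =>
    intro f hf hz
    refine ⟨0, ?_⟩
    rw [eq_C_of_natDegree_le_zero hf] at hz ⊢
    simp at hz
    simp [hz]
  | succ n ih =>
    intro f hf hz
    by_cases hf' : f.natDegree ≤ n
    · exact ih f hf' hz
    have hd : f.natDegree = n + 1 := by omega
    have h1 := isIntegral_leadingCoeff_smul f z hz
    have h2 : IsIntegral ℤ (f.leadingCoeff • z) := isIntegral_trans _ h1
    set b : integralClosure ℤ ℂ := ⟨_, h2⟩ with hb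
    have hbz : (b : ℂ) = (f.leadingCoeff : ℂ) * z := rfl
    have hfl : f = f.eraseLead + C f.leadingCoeff * X ^ (n + 1) := by
      conv_lhs => rw [← eraseLead_add_C_mul_X_pow f, hd]
    have hfm : f.map (algebraMap _ ℂ) = f.eraseLead.map (algebraMap _ ℂ) + C (f.leadingCoeff : ℂ) * X ^ (n+1) := by
      conv_lhs => rw [hfl]
      simp
    obtain ⟨g, hg⟩ := ih (f.eraseLead + C b * X ^ n) (by
      refine (natDegree_add_le _ _).trans (max_le ?_ ?_)
      · have := eraseLead_natDegree_le f
        omega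
      · exact natDegree_C_mul_X_pow_le _ _) (by
      rw [hfl] at hz
      simp only [map_add, map_mul, aeval_C, map_pow, aeval_X] at hz ⊢
      rw [← hz]
      change _ + (b : ℂ) * _ = _ + (f.leadingCoeff : ℂ) * _
      rw [hbz]; ring)
    refine ⟨g + C f.leadingCoeff * X ^ n, ?_⟩
    have e1 : (g + C f.leadingCoeff * X ^ n).map (algebraMap _ ℂ) = g.map (algebraMap _ ℂ) + C (f.leadingCoeff : ℂ) * X ^ n := by
      simp
    have e2 : (f.eraseLead + C b * X ^ n).map (algebraMap _ ℂ) = f.eraseLead.map (algebraMap _ ℂ) + C ((f.leadingCoeff : ℂ) * z) * X ^ n := by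
      simp [← hbz]
    rw [e1, mul_add, ← hg, e2, hfm, C_mul]
    ring

theorem prod_sub_int (a : ℂ) (t : Multiset ℂ) : ∀ u : Multiset ℂ,
    (∃ f : (integralClosure ℤ ℂ)[X], f.map (algebraMap _ ℂ) = C a * ((u + t).map (fun z => X - C z)).prod) →
    ∃ f : (integralClosure ℤ ℂ)[X], f.map (algebraMap _ ℂ) = C a * (t.map (fun z => X - C z)).prod := by
  intro u
  induction u using Multiset.induction with
  | empty => simp
  | cons z u ih =>
    rintro ⟨f, hf⟩
    apply ih
    obtain ⟨g, hg⟩ := div_root z _ f le_rfl (by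
      rw [← eval_map_algebraMap, hf]; simp)
    refine ⟨g, ?_⟩
    have hX : (X - C z : ℂ[X]) ≠ 0 := X_sub_C_ne_zero z
    apply mul_left_cancel₀ hX
    rw [← hg, hf]
    simp
    ring

theorem lead_mul_prod (P : ℤ[X]) (s : Multiset ℂ) (hs : s ≤ (P.map (Int.castRingHom ℂ)).roots) :
    IsIntegral ℤ ((P.leadingCoeff : ℂ) * s.prod) := by
  obtain ⟨u, hu⟩ := Multiset.le_iff_exists_add.mp hs
  obtain ⟨f, hf⟩ := prod_sub_int P.leadingCoeff s u ⟨P.map (algebraMap ℤ _), by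
    have h1 := (IsAlgClosed.splits (P.map (Int.castRingHom ℂ))).eq_prod_roots
    rw [Polynomial.map_map, add_comm, ← hu, ]
    refine Eq.trans ?_ (h1.trans ?_)
    · congr 1
    · congr 2
      rw [leadingCoeff_map_of_injective (RingHom.injective_int _)]; simp⟩
  have h2 := congrArg (fun p => p.eval 0) hf
  simp only [eval_mul, eval_C, eval_multiset_prod, Multiset.map_map, Function.comp_def, eval_sub, eval_X,
    zero_sub, eval_zero_map] at h2
  rw [Multiset.prod_map_neg] at h2
  have h3 : IsIntegral ℤ ((P.leadingCoeff : ℂ) * ((-1) ^ s.card * s.prod)) := by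
    rw [← h2]
    exact (f.eval 0).2
  have h4 : IsIntegral ℤ ((-1 : ℂ) ^ s.card) := (isIntegral_one.neg).pow _
  have h6 := h3.mul h4
  have h5 : ((-1 : ℂ) ^ s.card) * (-1) ^ s.card = 1 := by rw [← mul_pow]; simp
  have h7 : (P.leadingCoeff : ℂ) * s.prod
      = (P.leadingCoeff : ℂ) * ((-1) ^ s.card * s.prod) * (-1) ^ s.card := by
    linear_combination (-(P.leadingCoeff : ℂ) * s.prod) * h5
  rw [h7]
  exact h6

theorem coeff_zero_eq (P : ℤ[X]) :
    (P.coeff 0 : ℂ) = P.leadingCoeff * ((-1) ^ (P.map (Int.castRingHom ℂ)).roots.card *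
      (P.map (Int.castRingHom ℂ)).roots.prod) := by
  have h1 := (IsAlgClosed.splits (P.map (Int.castRingHom ℂ))).eq_prod_roots
  have h2 := congrArg (fun p => p.eval 0) h1
  simp only [eval_mul, eval_C, eval_multiset_prod, Multiset.map_map, Function.comp_def, eval_sub, eval_X,
    zero_sub, eval_zero_map] at h2
  rw [Multiset.prod_map_neg, leadingCoeff_map_of_injective (RingHom.injective_int _)] at h2
  rw [← coeff_zero_eq_eval_zero] at h2
  exact_mod_cast h2

theorem coeff_zero_div (P : ℤ[X]) (s : Multiset ℂ) (hs : s ≤ (P.map (Int.castRingHom ℂ)).roots)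
    (h0 : s.prod ≠ 0) : IsIntegral ℤ ((P.coeff 0 : ℂ) * s.prod⁻¹) := by
  obtain ⟨u, hu⟩ := Multiset.le_iff_exists_add.mp hs
  have h1 := lead_mul_prod P u (hu ▸ Multiset.le_add_left _ _)
  have h4 : IsIntegral ℤ ((-1 : ℂ) ^ (P.map (Int.castRingHom ℂ)).roots.card) :=
    (isIntegral_one.neg).pow _
  have h5 := h4.mul h1
  have h6 : (P.coeff 0 : ℂ) * s.prod⁻¹ =
      (-1 : ℂ) ^ (P.map (Int.castRingHom ℂ)).roots.card * ((P.leadingCoeff : ℂ) * u.prod) := by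
    have hpr : (P.map (Int.castRingHom ℂ)).roots.prod = s.prod * u.prod := by
      rw [hu, Multiset.prod_add]
    rw [coeff_zero_eq, hpr]
    field_simp
  rw [h6]
  exact h5

theorem orbit_of_next (α : ℂ) (h : (Set.range fun m : ℕ => mahlerC^[m] (mahlerC α)).Finite) :
    (Set.range fun m : ℕ => mahlerC^[m] α).Finite := by
  refine (h.insert α).subset ?_
  rintro _ ⟨m, rfl⟩
  cases m with
  | zero => left; rfl
  | succ m => right; exact ⟨m, rfl⟩

theorem orbit_of_inv (S : Set ℂ) (hS : S.Finite) (hm : ∀ z ∈ S, mahlerC z ∈ S) (α : ℂ) (h : α ∈ S) :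
    (Set.range fun m : ℕ => mahlerC^[m] α).Finite := by
  refine hS.subset ?_
  rintro _ ⟨m, rfl⟩
  induction m with
  | zero => exact h
  | succ m ih =>
    simp only [Function.iterate_succ_apply'] at ih ⊢
    exact hm _ ih

theorem mahlerC_nat (k : ℕ) : mahlerC (k : ℂ) = ((max 1 k : ℕ) : ℂ) := by
  have h : IsIntegral ℤ (k : ℂ) := by
    have := isIntegral_algebraMap (R := ℤ) (A := ℂ) (x := (k : ℤ))
    simpa using this
  have h1 : minpoly ℚ (k : ℂ) = X - C (k : ℚ) := by
    have := minpoly.eq_X_sub_C ℂ (k : ℚ)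
    simpa using this
  rw [mahlerC, mahlerM_eq' _ h, h1]
  have h2 : (X - C (k : ℚ)).aroots ℂ = {(k : ℂ)} := by
    rw [aroots_X_sub_C]; simp
  rw [h2]
  have h3 : (max 1 (k : ℝ)) = ((max 1 k : ℕ) : ℝ) := by push_cast; rfl
  rw [Multiset.map_singleton, Multiset.prod_singleton, Complex.norm_natCast, h3]
  exact Complex.ofReal_natCast _

theorem orbit_nat (k : ℕ) : (Set.range fun m : ℕ => mahlerC^[m] (k : ℂ)).Finite := by
  refine orbit_of_inv (Set.image (fun j : ℕ => (j : ℂ)) (Set.Iic (max 1 k))) ((Set.finite_Iic _).image _) ?_ _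
    ⟨k, le_max_right 1 k, rfl⟩
  rintro _ ⟨j, hj, rfl⟩
  have hj' : j ≤ max 1 k := hj
  have hj2 : max 1 j ≤ max 1 k := by omega
  exact ⟨max 1 j, hj2, (mahlerC_nat j).symm⟩

theorem aroots_embed {E : Type*} [Field E] [NumberField E] (y : E)
    (hd : (minpoly ℚ y).natDegree = Module.finrank ℚ E) :
    (minpoly ℚ y).aroots ℂ = (Finset.univ : Finset (E →+* ℂ)).val.map (fun σ => σ y) := by
  classical
  have hsep : (minpoly ℚ y).Separable := (minpoly.irreducible (Algebra.IsIntegral.isIntegral y)).separable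
  have hn : ((minpoly ℚ y).aroots ℂ).Nodup := nodup_roots hsep.map
  have hc : ((minpoly ℚ y).aroots ℂ).card = Module.finrank ℚ E := by
    rw [← hd, aroots_def, ← (IsAlgClosed.splits _).natDegree_eq_card_roots, natDegree_map]
  have hr := NumberField.Embeddings.range_eval_eq_rootSet_minpoly E ℂ y
  have himg : (Finset.univ : Finset (E →+* ℂ)).image (fun σ => σ y) = ((minpoly ℚ y).aroots ℂ).toFinset := by
    apply Finset.coe_injective
    rw [Finset.coe_image, Finset.coe_univ, Set.image_univ, hr, rootSet_def]
  have hinj : Set.InjOn (fun σ : E →+* ℂ => σ y) (Finset.univ : Finset (E →+* ℂ)) := by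
    rw [← Finset.card_image_iff, himg, Multiset.toFinset_card_of_nodup hn, hc, Finset.card_univ,
      NumberField.Embeddings.card]
  rw [← Finset.image_val_of_injOn hinj, himg, Multiset.toFinset_val, hn.dedup]
theorem prod_max_cases {ι : Type*} [Fintype ι] (hc : Fintype.card ι = 3) (t : ι → ℝ) (ht : ∀ i, 0 < t i) :
    (∏ i, max 1 (t i) = 1) ∨ (∃ i, ∏ i, max 1 (t i) = t i) ∨
    ((∃ i, ∏ i, max 1 (t i) = (∏ i, t i) / t i) ∧ ∃ j, t j ≤ 1) ∨
    ∏ i, max 1 (t i) = ∏ i, t i := by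
  have e := Fintype.equivFinOfCardEq hc
  rw [← e.symm.prod_comp, ← e.symm.prod_comp, Fin.prod_univ_three, Fin.prod_univ_three]
  have h0 := ht (e.symm 0)
  have h1 := ht (e.symm 1)
  have h2 := ht (e.symm 2)
  rcases le_total (t (e.symm 0)) 1 with a0 | a0 <;>
  rcases le_total (t (e.symm 1)) 1 with a1 | a1 <;>
  rcases le_total (t (e.symm 2)) 1 with a2 | a2 <;>
  simp only [max_eq_left, max_eq_right, a0, a1, a2, one_mul, mul_one]
  · left; trivial
  · right; left; exact ⟨_, rfl⟩
  · right; left; exact ⟨_, rfl⟩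
  · right; right; left; exact ⟨⟨e.symm 0, by field_simp⟩, ⟨_, a0⟩⟩
  · right; left; exact ⟨_, rfl⟩
  · right; right; left; exact ⟨⟨e.symm 1, by field_simp⟩, ⟨_, a1⟩⟩
  · right; right; left; exact ⟨⟨e.symm 2, by field_simp⟩, ⟨_, a2⟩⟩
  · right; right; right; trivial

theorem natAbs_mul_int {R : Type*} [CommRing R] (n : ℤ) (z : R) (h : IsIntegral ℤ ((n : R) * z)) :
    IsIntegral ℤ ((n.natAbs : R) * z) := by
  have hcast : ((n.natAbs : ℕ) : R) = ((n.natAbs : ℤ) : R) := by simp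
  rcases Int.natAbs_eq n with h1 | h1
  · rw [hcast, ← h1]; exact h
  · have : ((n.natAbs : ℤ) : R) * z = -((n : R) * z) := by
      conv_rhs => rw [h1]
      push_cast; ring
    rw [hcast, this]; exact h.neg

theorem int_of_map {E : Type*} [Field E] (e : E →+* ℂ) (z : E) (h : IsIntegral ℤ (e z)) :
    IsIntegral ℤ z :=
  (isIntegral_algHom_iff (e.toIntAlgHom) e.injective).1 h

theorem minpoly_embed {E : Type*} [Field E] [NumberField E] (e : E →+* ℂ) (y : E) :
    minpoly ℚ (e y) = minpoly ℚ y :=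
  minpoly.algHom_eq e.toRatAlgHom e.injective y

theorem integral_embed {E : Type*} [Field E] [NumberField E] (e : E →+* ℂ) (y : E) :
    IsIntegral ℚ (e y) :=
  (Algebra.IsIntegral.isIntegral (R := ℚ) y).map e.toRatAlgHom

theorem intMinpoly_embed {E : Type*} [Field E] [NumberField E] (e e' : E →+* ℂ) (y : E) :
    intMinpoly (e y) = intMinpoly (e' y) := by
  rw [intMinpoly, intMinpoly, minpoly_embed, minpoly_embed]

theorem coeff_zero_norm (P : ℤ[X]) :
    (((P.coeff 0).natAbs : ℕ) : ℝ) = P.leadingCoeff.natAbs *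
      ((P.map (Int.castRingHom ℂ)).roots.map (fun z => ‖z‖)).prod := by
  have h := congrArg norm (coeff_zero_eq P)
  rw [norm_mul, norm_mul, norm_pow, norm_neg, norm_one, one_pow, one_mul] at h
  have h2 : ‖(P.map (Int.castRingHom ℂ)).roots.prod‖ =
      ((P.map (Int.castRingHom ℂ)).roots.map (fun z => ‖z‖)).prod :=
    map_multiset_prod (normHom : ℂ →*₀ ℝ) _
  rw [h2] at h
  simpa [Nat.cast_natAbs] using h

theorem embed_data {F : Type*} [Field F] [NumberField F] (y : F)
    (hd : (minpoly ℚ y).natDegree = Module.finrank ℚ F) (hy0 : y ≠ 0) :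
    ∃ a c : ℕ, 0 < a ∧ (c : ℝ) = a * ∏ e : F →+* ℂ, ‖e y‖ ∧
      (∀ e : F →+* ℂ, mahlerM (e y) = a * ∏ e : F →+* ℂ, max 1 ‖e y‖) ∧
      IsIntegral ℤ ((a : F) * y) ∧ IsIntegral ℤ ((c : F) * y⁻¹) ∧ (IsIntegral ℤ y → a = 1) := by
  obtain ⟨e⟩ : Nonempty (F →+* ℂ) := inferInstance
  have hroots := intMinpoly_roots (e y) (integral_embed e y)
  rw [minpoly_embed, aroots_embed y hd] at hroots
  have hs : ({e y} : Multiset ℂ) ≤ ((intMinpoly (e y)).map (Int.castRingHom ℂ)).roots := by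
    rw [hroots, Multiset.singleton_le, Multiset.mem_map]
    exact ⟨e, Finset.mem_univ e, rfl⟩
  refine ⟨(intMinpoly (e y)).leadingCoeff.natAbs, ((intMinpoly (e y)).coeff 0).natAbs, ?_, ?_, ?_, ?_, ?_, ?_⟩
  · have := intMinpoly_ne_zero (e y) (integral_embed e y)
    rw [Int.natAbs_pos]; simpa using this
  · rw [coeff_zero_norm, hroots, Multiset.map_map]; rfl
  · intro e'
    rw [mahlerM, intMinpoly_embed e' e, hroots, Multiset.map_map]; rfl
  · apply natAbs_mul_int
    apply int_of_map e
    simpa using lead_mul_prod _ _ hs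
  · apply natAbs_mul_int
    apply int_of_map e
    simpa using coeff_zero_div _ _ hs (by simpa using hy0)
  · intro hy
    exact intMinpoly_lead _ (hy.map e.toIntAlgHom)

theorem deg_three {F : Type*} [Field F] [NumberField F] (h3 : Module.finrank ℚ F = 3) (y : F)
    (hy : y ∉ (algebraMap ℚ F).range) : (minpoly ℚ y).natDegree = Module.finrank ℚ F := by
  have h1 := minpoly.degree_dvd (K := ℚ) (Algebra.IsIntegral.isIntegral (R := ℚ) y)
  rw [h3] at h1 ⊢
  rcases (Nat.dvd_prime Nat.prime_three).1 h1 with h | h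
  · exact absurd (minpoly.natDegree_eq_one_iff.1 h) hy
  · exact h

theorem ofReal_norm_embed {F : Type*} [Field F] (e : F →+* ℂ) (y : F) (h : (e y).im = 0) :
    ((‖e y‖ : ℝ) : ℂ) = e y ∨ ((‖e y‖ : ℝ) : ℂ) = e (-y) := by
  have h1 : e y = ((e y).re : ℂ) := by apply Complex.ext <;> simp [h]
  rw [map_neg, h1]
  simp only [Complex.norm_real, Real.norm_eq_abs]
  rcases abs_choice (e y).re with h2 | h2
  · left; rw [h2]
  · right; rw [h2]; simp

theorem mahler_cubic {F : Type*} [Field F] [NumberField F] (h3 : Module.finrank ℚ F = 3)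
    (hreal : ∀ e : F →+* ℂ, ∀ x : F, (e x).im = 0) (y : F) (hy0 : y ≠ 0)
    (hy : y ∉ (algebraMap ℚ F).range) (hintg : IsIntegral ℤ y) (e : F →+* ℂ) :
    mahlerC ((‖e y‖ : ℝ) : ℂ) = ((∏ e : F →+* ℂ, max 1 ‖e y‖ : ℝ) : ℂ) := by
  rw [mahlerC]
  congr 1
  rcases ofReal_norm_embed e y (hreal e y) with h | h
  · obtain ⟨a, c, -, -, h1, -, -, h2⟩ := embed_data y (deg_three h3 y hy) hy0
    rw [h, h1, h2 hintg]; simp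
  · obtain ⟨a, c, -, -, h1, -, -, h2⟩ := embed_data (-y) (deg_three h3 (-y) (by simpa using hy)) (by simpa using hy0)
    rw [h, h1, h2 hintg.neg]; simp

theorem orbit_rat {F : Type*} [Field F] [NumberField F] (x : F) (hintg : IsIntegral ℤ x)
    (hx : x ∈ (algebraMap ℚ F).range) (e : F →+* ℂ) :
    (Set.range fun m : ℕ => mahlerC^[m] ((‖e x‖ : ℝ) : ℂ)).Finite := by
  obtain ⟨q, rfl⟩ := hx
  have hq : IsIntegral ℤ q := (isIntegral_algebraMap_iff (algebraMap ℚ F).injective).1 hintg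
  obtain ⟨k, rfl⟩ := IsIntegrallyClosed.isIntegral_iff.1 hq
  have h1 : ((‖e (algebraMap ℚ F (algebraMap ℤ ℚ k))‖ : ℝ) : ℂ) = (k.natAbs : ℂ) := by
    have : (k.natAbs : ℂ) = ((k.natAbs : ℝ) : ℂ) := (Complex.ofReal_natCast _).symm
    rw [this, Nat.cast_natAbs, Int.cast_abs]
    simp
  rw [h1]
  exact orbit_nat k.natAbs

theorem not_rat_mul {F : Type*} [Field F] [NumberField F] (x : F) (m : ℕ) (hm : 1 ≤ m)
    (hx : x ∉ (algebraMap ℚ F).range) : (m : F) * x ∉ (algebraMap ℚ F).range := by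
  rintro ⟨q, hq⟩
  apply hx
  refine ⟨q / m, ?_⟩
  have : (m : F) ≠ 0 := by exact_mod_cast (by omega : m ≠ 0)
  rw [map_div₀, hq]; simp; field_simp

theorem not_rat_inv {F : Type*} [Field F] [NumberField F] (x : F)
    (hx : x ∉ (algebraMap ℚ F).range) : x⁻¹ ∉ (algebraMap ℚ F).range := by
  rintro ⟨q, hq⟩
  apply hx
  refine ⟨q⁻¹, ?_⟩
  rw [map_inv₀, hq, inv_inv]

theorem orbit_main {F : Type*} [Field F] [NumberField F] (h3 : Module.finrank ℚ F = 3)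
    (hreal : ∀ e : F →+* ℂ, ∀ x : F, (e x).im = 0) (x : F) (hx0 : x ≠ 0)
    (hintg : IsIntegral ℤ x) (e₀ : F →+* ℂ) :
    (Set.range fun m : ℕ => mahlerC^[m] ((‖e₀ x‖ : ℝ) : ℂ)).Finite := by
  by_cases hx : x ∈ (algebraMap ℚ F).range
  · exact orbit_rat x hintg hx e₀
  have hcard : Fintype.card (F →+* ℂ) = 3 := by rw [NumberField.Embeddings.card, h3]
  obtain ⟨a, N, ha, hN, -, -, hNint, h1⟩ := embed_data x (deg_three h3 x hx) hx0
  have ha1 := h1 hintg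
  subst ha1
  rw [Nat.cast_one, one_mul] at hN
  have hpos : ∀ e : F →+* ℂ, 0 < ‖e x‖ := fun e => by simpa using hx0
  have hNpos : (0 : ℝ) < N := by rw [hN]; exact Finset.prod_pos fun e _ => hpos e
  have hN1 : 1 ≤ N := by exact_mod_cast hNpos
  have hNF : (N : F) ≠ 0 := by exact_mod_cast (by omega : N ≠ 0)
  obtain ⟨L, hL1, hLA, hLB⟩ : ∃ L : ℕ, 1 ≤ L ∧ (∀ e : F →+* ℂ, 1 < L * ‖e x‖) ∧
      (∀ e : F →+* ℂ, 1 < L * (N / ‖e x‖)) := by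
    obtain ⟨L, hL⟩ := exists_nat_gt (1 + ∑ e : F →+* ℂ, (1 / ‖e x‖ + ‖e x‖ / N))
    have hnn : ∀ e : F →+* ℂ, 0 < 1 / ‖e x‖ + ‖e x‖ / N := fun e => by
      have := hpos e; positivity
    have hle : ∀ e : F →+* ℂ, 1 / ‖e x‖ + ‖e x‖ / N ≤ ∑ e : F →+* ℂ, (1 / ‖e x‖ + ‖e x‖ / N) :=
      fun e => Finset.single_le_sum (f := fun e : F →+* ℂ => 1 / ‖e x‖ + ‖e x‖ / N)
        (fun e _ => (hnn e).le) (Finset.mem_univ e)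
    refine ⟨L, ?_, fun e => ?_, fun e => ?_⟩
    · have := hle e₀
      have := hnn e₀
      have : (1 : ℝ) ≤ L := by linarith
      exact_mod_cast this
    · have := hle e
      have h4 := hpos e
      have h5 : 0 < ‖e x‖ / N := by positivity
      have : 1 / ‖e x‖ < L := by linarith
      rwa [div_lt_iff₀ h4] at this
    · have := hle e
      have h4 := hpos e
      have h5 : 0 < 1 / ‖e x‖ := by positivity
      have : ‖e x‖ / N < L := by linarith
      rw [div_lt_iff₀ hNpos] at this
      rw [← mul_div_assoc, one_lt_div h4]
      exact this
  set B := L ^ 2 * N with hB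
  have hBL : L ^ 2 ≤ B := Nat.le_mul_of_pos_right _ hN1
  have hB1 : 1 ≤ B := le_trans (Nat.one_le_pow _ _ hL1) hBL
  have hBig : ∀ m ≤ B, m ^ 3 * N ≤ B ^ 3 * N ^ 2 ∧ m ^ 3 * N ^ 2 ≤ B ^ 3 * N ^ 2 := by
    intro m hm
    have h5 : m ^ 3 ≤ B ^ 3 := Nat.pow_le_pow_left hm 3
    have h6 : N ≤ N ^ 2 := Nat.le_self_pow (by norm_num) N
    exact ⟨Nat.mul_le_mul h5 h6, Nat.mul_le_mul_right _ h5⟩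
  have hBig1 : 1 ≤ B ^ 3 * N ^ 2 := Nat.mul_pos (Nat.pow_pos hB1) (Nat.pow_pos hN1)
  set S0 : Set ℂ := Set.image (fun j : ℕ => (j : ℂ)) (Set.Iic (B ^ 3 * N ^ 2)) with hS0
  set SA : Set ℂ := Set.image (fun p : ℕ × (F →+* ℂ) => (((p.1 : ℝ) * ‖p.2 x‖ : ℝ) : ℂ)) ((Set.Icc 1 B ×ˢ Set.univ)) with hSA
  set SB : Set ℂ := Set.image (fun p : ℕ × (F →+* ℂ) => (((p.1 : ℝ) * (N / ‖p.2 x‖) : ℝ) : ℂ)) ((Set.Icc 1 B ×ˢ Set.univ)) with hSB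
  refine orbit_of_inv (S0 ∪ SA ∪ SB) ?_ ?_ _ ?_
  · exact (((Set.finite_Iic _).image _).union (((Set.finite_Icc _ _).prod Set.finite_univ).image _)).union
      (((Set.finite_Icc _ _).prod Set.finite_univ).image _)
  · rintro z ((⟨j, hj, rfl⟩ | ⟨⟨m, e⟩, ⟨⟨hm1, hmB⟩, -⟩, rfl⟩) | ⟨⟨m, e⟩, ⟨⟨hm1, hmB⟩, -⟩, rfl⟩)
    · left; left
      refine ⟨max 1 j, ?_, (mahlerC_nat j).symm⟩
      exact max_le hBig1 hj
    · simp only at hm1 hmB ⊢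
      have hmpos : (0 : ℝ) < m := by exact_mod_cast hm1
      have hnorm : ∀ e : F →+* ℂ, ‖e ((m : F) * x)‖ = m * ‖e x‖ := fun e => by simp
      have hmF : (m : F) ≠ 0 := by exact_mod_cast (by omega : m ≠ 0)
      have key := mahler_cubic h3 hreal ((m : F) * x) (mul_ne_zero hmF hx0) (not_rat_mul x m hm1 hx)
        ((isIntegral_natCast m).mul hintg) e
      simp only [hnorm] at key
      rw [key]
      have hQ : ∏ e : F →+* ℂ, ((m : ℝ) * ‖e x‖) = m ^ 3 * N := by
        rw [Finset.prod_mul_distrib, Finset.prod_const, Finset.card_univ, hcard, hN]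
      rcases prod_max_cases hcard (fun e : F →+* ℂ => (m : ℝ) * ‖e x‖) (fun e => mul_pos hmpos (hpos e))
        with h | ⟨i, h⟩ | ⟨⟨i, h⟩, ⟨j, hj⟩⟩ | h
      · rw [h]; left; left; exact ⟨1, hBig1, by simp⟩
      · rw [h]; left; right; exact ⟨(m, i), ⟨⟨hm1, hmB⟩, trivial⟩, rfl⟩
      · rw [h, hQ]; right
        have hmL : m ≤ L := by
          by_contra hcon
          have h7 : (L : ℝ) ≤ m := by exact_mod_cast (by omega : L ≤ m)
          have := hLA j
          have := mul_le_mul_of_nonneg_right h7 (hpos j).le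
          linarith
        refine ⟨(m ^ 2, i), ⟨⟨Nat.one_le_pow _ _ hm1, (Nat.pow_le_pow_left hmL 2).trans hBL⟩, trivial⟩, ?_⟩
        have := hpos i
        push_cast
        field_simp
      · rw [h, hQ]; left; left
        exact ⟨m ^ 3 * N, (hBig m hmB).1, by push_cast; rfl⟩
    · simp only at hm1 hmB ⊢
      have hmpos : (0 : ℝ) < m := by exact_mod_cast hm1
      have hnorm : ∀ e : F →+* ℂ, ‖e ((m : F) * ((N : F) * x⁻¹))‖ = m * (N / ‖e x‖) := fun e => by
        simp [div_eq_mul_inv]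
      have hmF : (m : F) ≠ 0 := by exact_mod_cast (by omega : m ≠ 0)
      have key := mahler_cubic h3 hreal ((m : F) * ((N : F) * x⁻¹))
        (mul_ne_zero hmF (mul_ne_zero hNF (inv_ne_zero hx0)))
        (not_rat_mul _ m hm1 (not_rat_mul _ N hN1 (not_rat_inv x hx)))
        ((isIntegral_natCast m).mul hNint) e
      simp only [hnorm] at key
      rw [key]
      have hQ : ∏ e : F →+* ℂ, ((m : ℝ) * (N / ‖e x‖)) = m ^ 3 * N ^ 2 := by
        rw [Finset.prod_mul_distrib, Finset.prod_const, Finset.card_univ, hcard, Finset.prod_div_distrib,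
          ← hN, Finset.prod_const, Finset.card_univ, hcard]
        field_simp
      rcases prod_max_cases hcard (fun e : F →+* ℂ => (m : ℝ) * (N / ‖e x‖))
        (fun e => mul_pos hmpos (div_pos hNpos (hpos e)))
        with h | ⟨i, h⟩ | ⟨⟨i, h⟩, ⟨j, hj⟩⟩ | h
      · rw [h]; left; left; exact ⟨1, hBig1, by simp⟩
      · rw [h]; right; exact ⟨(m, i), ⟨⟨hm1, hmB⟩, trivial⟩, rfl⟩
      · rw [h, hQ]; left; right
        have hmL : m ≤ L := by
          by_contra hcon
          have h7 : (L : ℝ) ≤ m := by exact_mod_cast (by omega : L ≤ m)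
          have := hLB j
          have := mul_le_mul_of_nonneg_right h7 (div_pos hNpos (hpos j)).le
          linarith
        refine ⟨(m ^ 2 * N, i), ⟨⟨Nat.mul_pos (Nat.pow_pos hm1) hN1,
          Nat.mul_le_mul_right _ (Nat.pow_le_pow_left hmL 2)⟩, trivial⟩, ?_⟩
        have := hpos i
        push_cast
        field_simp
      · rw [h, hQ]; left; left
        exact ⟨m ^ 3 * N ^ 2, (hBig m hmB).2, by push_cast; rfl⟩
  · left; right
    exact ⟨(1, e₀), ⟨⟨le_rfl, hB1⟩, trivial⟩, by simp⟩

theorem orbit_start {F : Type*} [Field F] [NumberField F] (h3 : Module.finrank ℚ F = 3)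
    (hreal : ∀ e : F →+* ℂ, ∀ x : F, (e x).im = 0) (y : F) (hy0 : y ≠ 0) (a c : ℕ) (ha : 0 < a)
    (hc : (c : ℝ) = a * ∏ e : F →+* ℂ, ‖e y‖) (hia : IsIntegral ℤ ((a : F) * y))
    (hic : IsIntegral ℤ ((c : F) * y⁻¹)) :
    (Set.range fun m : ℕ => mahlerC^[m] ((a * ∏ e : F →+* ℂ, max 1 ‖e y‖ : ℝ) : ℂ)).Finite := by
  have hcard : Fintype.card (F →+* ℂ) = 3 := by rw [NumberField.Embeddings.card, h3]
  have hpos : ∀ e : F →+* ℂ, 0 < ‖e y‖ := fun e => by simpa using hy0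
  have haR : (0 : ℝ) < a := by exact_mod_cast ha
  have hcR : (0 : ℝ) < c := by
    rw [hc]; exact mul_pos haR (Finset.prod_pos fun e _ => hpos e)
  have haF : (a : F) ≠ 0 := by exact_mod_cast (by omega : a ≠ 0)
  have hcF : (c : F) ≠ 0 := by
    have : c ≠ 0 := by rintro rfl; simp at hcR
    exact_mod_cast this
  rcases prod_max_cases hcard (fun e : F →+* ℂ => ‖e y‖) hpos
    with h | ⟨i, h⟩ | ⟨⟨i, h⟩, -⟩ | h
  · rw [h]; simpa using orbit_nat a
  · rw [h]
    have := orbit_main h3 hreal _ (mul_ne_zero haF hy0) hia i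
    simpa using this
  · rw [h, ← mul_div_assoc, ← hc]
    have := orbit_main h3 hreal _ (mul_ne_zero hcF (inv_ne_zero hy0)) hic i
    simpa [div_eq_mul_inv] using this
  · rw [h, ← hc]; simpa using orbit_nat c

theorem orbit_nat_case (α : ℂ) (h : IsIntegral ℚ α)
    (h2 : (((minpoly ℚ α).aroots ℂ).map (fun z => max 1 ‖z‖)).prod = 1 ∨
      (((minpoly ℚ α).aroots ℂ).map (fun z => max 1 ‖z‖)).prod =
        (((minpoly ℚ α).aroots ℂ).map (fun z => ‖z‖)).prod) :
    (Set.range fun m : ℕ => mahlerC^[m] α).Finite := by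
  apply orbit_of_next
  rw [mahlerC, mahlerM_eq α h]
  rcases h2 with h2 | h2
  · rw [h2, mul_one, Complex.ofReal_natCast]; exact orbit_nat _
  · rw [h2, ← intMinpoly_roots α h, ← coeff_zero_norm, Complex.ofReal_natCast]; exact orbit_nat _

theorem orbit_F {F : Type*} [Field F] [NumberField F] (h3 : Module.finrank ℚ F = 3)
    (hreal : ∀ e : F →+* ℂ, ∀ x : F, (e x).im = 0) (y : F) (e : F →+* ℂ) :
    (Set.range fun m : ℕ => mahlerC^[m] (e y)).Finite := by
  by_cases hy : y ∈ (algebraMap ℚ F).range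
  · apply orbit_nat_case _ (integral_embed e y)
    obtain ⟨q, rfl⟩ := hy
    rw [minpoly_embed, minpoly.eq_X_sub_C, aroots_X_sub_C]
    simpa using le_total _ _
  · have hy0 : y ≠ 0 := by rintro rfl; exact hy (zero_mem _)
    obtain ⟨a, c, ha, hc, hM, hia, hic, -⟩ := embed_data y (deg_three h3 y hy) hy0
    apply orbit_of_next
    rw [mahlerC, hM]
    exact orbit_start h3 hreal y hy0 a c ha hc hia hic

section CM
variable {F K : Type*} [Field F] [NumberField F] [Field K] [NumberField K] [Algebra F K]

theorem nonreal (h2 : Module.finrank F K = 2)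
    (hreal : ∀ e : F →+* ℂ, ∀ x : F, (e x).im = 0)
    (α : K) (hα : α ∉ (algebraMap F K).range) (σ : K →+* ℂ) (him : ∃ x : K, (σ x).im ≠ 0) :
    (σ α).im ≠ 0 := by
  intro h0
  have hs := IntermediateField.isSimpleOrder_of_finrank_prime F K (by rw [h2]; exact Nat.prime_two)
  have hmem : ∀ z : ℂ, z ∈ Complex.ofRealHom.fieldRange ↔ z.im = 0 := by
    intro z
    constructor
    · rintro ⟨r, rfl⟩; simp
    · intro h; exact ⟨z.re, by apply Complex.ext <;> simp [h]⟩
  let E : IntermediateField F K := (Complex.ofRealHom.fieldRange.comap σ).toIntermediateField (by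
    intro x
    change σ (algebraMap F K x) ∈ Complex.ofRealHom.fieldRange
    rw [hmem]
    exact hreal (σ.comp (algebraMap F K)) x)
  have hE : ∀ x : K, x ∈ E ↔ (σ x).im = 0 := fun x => hmem (σ x)
  rcases hs.eq_bot_or_eq_top E with h | h
  · apply hα
    have : α ∈ E := (hE α).2 h0
    rw [h, IntermediateField.mem_bot] at this
    exact this
  · obtain ⟨x, hx⟩ := him
    apply hx
    rw [← hE, h]
    trivial

theorem quad_norm (h2 : Module.finrank F K = 2)
    (hreal : ∀ e : F →+* ℂ, ∀ x : F, (e x).im = 0)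
    (him : ∀ σ : K →+* ℂ, ∃ x : K, (σ x).im ≠ 0)
    (α : K) (hα : α ∉ (algebraMap F K).range) :
    ∃ n : F, ∀ σ : K →+* ℂ, σ (algebraMap F K n) = σ α * (starRingEnd ℂ) (σ α) := by
  have hfin : FiniteDimensional F K := Module.finite_of_finrank_pos (by omega)
  have hintg : IsIntegral F α := Algebra.IsIntegral.isIntegral α
  have hd : (minpoly F α).natDegree = 2 := by
    have h1 := minpoly.degree_dvd (K := F) hintg
    rw [h2] at h1
    rcases (Nat.dvd_prime Nat.prime_two).1 h1 with h | h
    · exact absurd (minpoly.natDegree_eq_one_iff.1 h) hα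
    · exact h
  refine ⟨(minpoly F α).coeff 0, fun σ => ?_⟩
  have hnr := nonreal h2 hreal α hα σ (him σ)
  have hev := minpoly.aeval F α
  have hlead : (minpoly F α).coeff 2 = 1 := by
    have := minpoly.monic hintg
    rwa [Monic, leadingCoeff, hd] at this
  rw [aeval_eq_sum_range, hd] at hev
  simp only [Finset.sum_range_succ, Finset.sum_range_zero, zero_add, hlead, Algebra.smul_def, pow_zero,
    mul_one, pow_one, map_one, one_mul] at hev
  have h3 := congrArg σ hev
  simp only [map_add, map_mul, map_pow, map_zero] at h3
  have hb := hreal (σ.comp (algebraMap F K)) ((minpoly F α).coeff 1)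
  have hc := hreal (σ.comp (algebraMap F K)) ((minpoly F α).coeff 0)
  simp only [RingHom.comp_apply] at hb hc
  generalize σ (algebraMap F K ((minpoly F α).coeff 1)) = b at *
  generalize σ (algebraMap F K ((minpoly F α).coeff 0)) = c at *
  generalize σ α = z at *
  have hre := congrArg Complex.re h3
  have hi := congrArg Complex.im h3
  simp [pow_two, hb, hc] at hre hi
  have hb2 : b.re = - 2 * z.re := by
    apply mul_right_cancel₀ hnr
    linarith
  apply Complex.ext
  · simp; rw [hb2] at hre; linarith
  · simp [hc]; ring

theorem prod_fiber (h2 : Module.finrank F K = 2) (g : (F →+* ℂ) → ℝ) :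
    ∏ σ : K →+* ℂ, g (σ.comp (algebraMap F K)) = ∏ e : F →+* ℂ, g e ^ 2 := by
  classical
  have hfin : FiniteDimensional F K := Module.finite_of_finrank_pos (by omega)
  rw [← Finset.prod_fiberwise (s := Finset.univ) (fun σ : K →+* ℂ => σ.comp (algebraMap F K))]
  refine Finset.prod_congr rfl fun e _ => ?_
  rw [Finset.prod_congr rfl (g := fun _ => g e) (by
    intro σ hσ; rw [(Finset.mem_filter.1 hσ).2]), Finset.prod_const]
  congr 1
  let _ : Algebra F ℂ := e.toAlgebra
  rw [← h2, ← AlgHom.card F K ℂ, ← Finset.card_univ]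
  symm
  refine Finset.card_bij (fun f _ => (f : K →+* ℂ)) ?_ ?_ ?_
  · intro f _
    simp only [Finset.mem_filter, Finset.mem_univ, true_and]
    exact f.comp_algebraMap
  · intro f _ f' _ h
    exact AlgHom.coe_ringHom_injective h
  · intro σ hσ
    have := (Finset.mem_filter.1 hσ).2
    have hcm : ∀ r : F, σ (algebraMap F K r) = algebraMap F ℂ r := fun r => by
      change (σ.comp (algebraMap F K)) r = e r
      rw [this]
    exact ⟨AlgHom.mk σ hcm, Finset.mem_univ _, rfl⟩

theorem max_sq (t : ℝ) (ht : 0 ≤ t) : (max 1 t) ^ 2 = max 1 (t ^ 2) := by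
  rcases le_total t 1 with h | h
  · rw [max_eq_left h, max_eq_left (by nlinarith)]; norm_num
  · rw [max_eq_right h, max_eq_right (by nlinarith)]

theorem orbit_K (h6 : Module.finrank ℚ K = 6) (h3 : Module.finrank ℚ F = 3)
    (h2 : Module.finrank F K = 2)
    (hreal : ∀ e : F →+* ℂ, ∀ x : F, (e x).im = 0)
    (him : ∀ σ : K →+* ℂ, ∃ x : K, (σ x).im ≠ 0) (α : K) (σ : K →+* ℂ) :
    (Set.range fun m : ℕ => mahlerC^[m] (σ α)).Finite := by
  classical
  by_cases hα : α ∈ (algebraMap F K).range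
  · obtain ⟨y, rfl⟩ := hα
    exact orbit_F h3 hreal y (σ.comp (algebraMap F K))
  have hα0 : α ≠ 0 := by rintro rfl; exact hα (zero_mem _)
  have hnr : ∀ τ : K →+* ℂ, (τ α).im ≠ 0 := fun τ => nonreal h2 hreal α hα τ (him τ)
  have hintg := integral_embed σ α
  have hsep : (minpoly ℚ α).Separable := (minpoly.irreducible (Algebra.IsIntegral.isIntegral α)).separable
  have hnd : ((minpoly ℚ α).aroots ℂ).Nodup := nodup_roots hsep.map
  have hcard : ((minpoly ℚ α).aroots ℂ).card = (minpoly ℚ α).natDegree := by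
    rw [aroots_def, ← (IsAlgClosed.splits _).natDegree_eq_card_roots, natDegree_map]
  have hm0 : minpoly ℚ α ≠ 0 := hsep.ne_zero
  have hmem : ∀ z : ℂ, z ∈ (minpoly ℚ α).aroots ℂ ↔ ∃ τ : K →+* ℂ, τ α = z := by
    intro z
    have hr := NumberField.Embeddings.range_eval_eq_rootSet_minpoly K ℂ α
    have : z ∈ (minpoly ℚ α).aroots ℂ ↔ z ∈ (minpoly ℚ α).rootSet ℂ := by
      rw [mem_aroots, mem_rootSet]
    rw [this, ← hr]; rfl
  have hconj : ∀ z ∈ (minpoly ℚ α).aroots ℂ, (starRingEnd ℂ) z ∈ (minpoly ℚ α).aroots ℂ := by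
    intro z hz
    rw [hmem] at hz ⊢
    obtain ⟨τ, rfl⟩ := hz
    exact ⟨(starRingEnd ℂ).comp τ, rfl⟩
  have hne : ∀ z ∈ (minpoly ℚ α).aroots ℂ, (starRingEnd ℂ) z ≠ z := by
    intro z hz h
    obtain ⟨τ, rfl⟩ := (hmem z).1 hz
    exact hnr τ (Complex.conj_eq_iff_im.1 h)
  have hz : σ α ∈ (minpoly ℚ α).aroots ℂ := (hmem _).2 ⟨σ, rfl⟩
  have hle : ({σ α, (starRingEnd ℂ) (σ α)} : Multiset ℂ) ≤ (minpoly ℚ α).aroots ℂ := by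
    rw [Multiset.le_iff_subset]
    · intro w hw
      simp only [Multiset.insert_eq_cons, Multiset.mem_cons, Multiset.mem_singleton] at hw
      rcases hw with rfl | rfl
      · exact hz
      · exact hconj _ hz
    · simpa using (hne _ hz).symm
  have hdvd : (minpoly ℚ α).natDegree ∣ 6 := by
    rw [← h6]; exact minpoly.degree_dvd (Algebra.IsIntegral.isIntegral α)
  have heven : Even (minpoly ℚ α).natDegree := by
    have h1 : ∏ z ∈ ((minpoly ℚ α).aroots ℂ).toFinset, (-1 : ℤ) = 1 := by
      refine Finset.prod_involution (fun z _ => (starRingEnd ℂ) z) ?_ ?_ ?_ ?_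
      · intros; norm_num
      · intro z hz _; exact hne z (Multiset.mem_toFinset.1 hz)
      · intro z hz; exact Multiset.mem_toFinset.2 (hconj z (Multiset.mem_toFinset.1 hz))
      · intros; simp
    rw [Finset.prod_const, Multiset.toFinset_card_of_nodup hnd, hcard] at h1
    exact (neg_one_pow_eq_one_iff_even (by norm_num)).1 h1
  have hd : (minpoly ℚ α).natDegree = 2 ∨ (minpoly ℚ α).natDegree = 6 := by
    have := Nat.le_of_dvd (by norm_num) hdvd
    have := minpoly.natDegree_pos (Algebra.IsIntegral.isIntegral (R := ℚ) α)
    generalize (minpoly ℚ α).natDegree = d at *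
    clear * - hdvd heven this
    have h5 : d ≤ 6 := Nat.le_of_dvd (by norm_num) hdvd
    interval_cases d <;> revert hdvd heven this <;> decide
  rcases hd with hd | hd
  · have heq := Multiset.eq_of_le_of_card_le hle (by rw [hcard, hd]; simp)
    apply orbit_nat_case _ hintg
    rw [minpoly_embed, ← heq]
    simp only [Multiset.insert_eq_cons, Multiset.map_cons, Multiset.map_singleton, Multiset.prod_cons,
      Multiset.prod_singleton, RCLike.norm_conj]
    rcases le_total ‖σ α‖ 1 with h | h
    · left; rw [max_eq_left h]; norm_num
    · right; rw [max_eq_right h]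
  · obtain ⟨n, hn⟩ := quad_norm h2 hreal him α hα
    have hn0 : n ≠ 0 := by
      rintro rfl
      have := hn σ
      simp [hα0] at this
    have hnorm : ∀ τ : K →+* ℂ, ‖τ α‖ = √ ‖(τ.comp (algebraMap F K)) n‖ := by
      intro τ
      rw [RingHom.comp_apply, hn τ, norm_mul, RCLike.norm_conj, Real.sqrt_mul_self (norm_nonneg _)]
    have hP1 : ∏ τ : K →+* ℂ, ‖τ α‖ = ∏ e : F →+* ℂ, ‖e n‖ := by
      simp only [hnorm]
      rw [prod_fiber h2 (fun e => √ ‖e n‖)]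
      simp
    have hP2 : ∏ τ : K →+* ℂ, max 1 ‖τ α‖ = ∏ e : F →+* ℂ, max 1 ‖e n‖ := by
      simp only [hnorm]
      rw [prod_fiber h2 (fun e => max 1 (√ ‖e n‖))]
      refine Finset.prod_congr rfl fun e _ => ?_
      rw [max_sq _ (Real.sqrt_nonneg _), Real.sq_sqrt (norm_nonneg _)]
    have hroots := intMinpoly_roots (σ α) hintg
    rw [minpoly_embed] at hroots
    have hemb := aroots_embed α (hd.trans h6.symm)
    rw [← hroots] at hle
    apply orbit_of_next
    rw [mahlerC, mahlerM, hroots, hemb, Multiset.map_map]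
    have hfin := orbit_start h3 hreal n hn0 (intMinpoly (σ α)).leadingCoeff.natAbs
      ((intMinpoly (σ α)).coeff 0).natAbs
      (by
        have := intMinpoly_ne_zero (σ α) hintg
        rw [Int.natAbs_pos]; simpa using this)
      (by rw [coeff_zero_norm, hroots, hemb, Multiset.map_map, ← hP1]; rfl)
      (by
        apply natAbs_mul_int
        apply int_of_map (σ.comp (algebraMap F K))
        have := lead_mul_prod _ _ hle
        simpa [hn] using this)
      (by
        apply natAbs_mul_int
        apply int_of_map (σ.comp (algebraMap F K))
        have := coeff_zero_div _ _ hle (by simpa using hα0)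
        simpa [hn] using this)
    rw [← hP2] at hfin
    exact hfin

end CM

theorem cm_sextic_preperiodic (K : IntermediateField ℚ ℂ)
    [FiniteDimensional ℚ K] (h6 : Module.finrank ℚ K = 6)
    (him : ∀ φ : K →+* ℂ, ∃ x : K, (φ x).im ≠ 0)
    (F : IntermediateField ℚ ℂ) (hFK : F ≤ K)
    (hFreal : ∀ φ : F →+* ℂ, ∀ x : F, (φ x).im = 0)
    (hF3 : Module.finrank ℚ F = 3) :
    ∀ α : K, (Set.range fun m : ℕ => mahlerC^[m] (α : ℂ)).Finite := by
  intro α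
  have _ : FiniteDimensional ℚ F := Module.finite_of_finrank_pos (by omega)
  have _ : NumberField K := ⟨⟩
  have _ : NumberField F := ⟨⟩
  let _ : Algebra F K := (IntermediateField.inclusion hFK).toRingHom.toAlgebra
  have h2 : Module.finrank F K = 2 := by
    have := Module.finrank_mul_finrank ℚ F K
    rw [h6, hF3] at this
    omega
  exact orbit_K h6 hF3 h2 hFreal him α K.val.toRingHom
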